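/- Let μ be a partition, r a residue, and suppose μ has b beads on runner r and a beads on runner r−1 of its p-abacus. If b > a, then μ has at least b − a normal r-nodes. -/

import Mathlib

/-- Removable `r`-nodes of the abacus configuration `S` (positions 0-indexed,
runner of position `m` is `m % p`): beads on runner `r` with an empty position
immediately to the left. -/
def removables (p r : ℕ) (S : Finset ℕ) : Finset ℕ :=
  S.filter (fun m => m % p = r ∧ 0 < m ∧ m - 1 ∉ S)

/-- Addable `r`-nodes: empty positions on runner `r` whose left neighbour (on
runner `r - 1`) carries a bead. -/
def addables (p r : ℕ) (S : Finset ℕ) : Finset ℕ :=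
  (S.image (fun m => m + 1)).filter (fun m => m % p = r ∧ m ∉ S)

/-- Normal `r`-nodes: removable `r`-nodes `m` such that for every addable `r`-node
`m'` in an earlier row (i.e. at a larger abacus position), there are strictly more
removable than addable `r`-nodes strictly between them. -/
def normals (p r : ℕ) (S : Finset ℕ) : Finset ℕ :=
  (removables p r S).filter (fun m => ∀ m' ∈ addables p r S, m < m' →
    ((addables p r S).filter (fun x => m < x ∧ x < m')).card <
      ((removables p r S).filter (fun x => m < x ∧ x < m')).card)

theorem mod_succ_iff (p r k : ℕ) (hr : 0 < r) (hrp : r < p) :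
    (k + 1) % p = r ↔ k % p = r - 1 := by
  have h1 : k % p < p := Nat.mod_lt _ (by omega)
  have h2 : (k + 1) % p = (k % p + 1) % p := by simp [Nat.add_mod]
  rw [h2]
  by_cases h : k % p + 1 = p
  · rw [h, Nat.mod_self]; omega
  · rw [Nat.mod_eq_of_lt (by omega)]; omega

/-- Counting elements of `X` that are `≥ t`. -/
def cntGe (X : Finset ℕ) (t : ℕ) : ℕ := (X.filter (fun x => t ≤ x)).card

theorem cntGe_step (X : Finset ℕ) (t : ℕ) :
    cntGe X t = cntGe X (t + 1) + if t ∈ X then 1 else 0 := by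
  unfold cntGe
  split_ifs with h
  · have : X.filter (fun x => t ≤ x) = insert t (X.filter (fun x => t + 1 ≤ x)) := by
      ext x; simp only [Finset.mem_filter, Finset.mem_insert]
      constructor
      · rintro ⟨a, b⟩
        by_cases hx : x = t
        · exact Or.inl hx
        · exact Or.inr ⟨a, by omega⟩
      · rintro (rfl | ⟨a, b⟩)
        · exact ⟨h, le_refl _⟩
        · exact ⟨a, by omega⟩
    rw [this, Finset.card_insert_of_notMem (by simp)]
  · congr 1
    ext x; simp only [Finset.mem_filter]
    constructor
    · rintro ⟨a, b⟩
      have : x ≠ t := fun e => h (e ▸ a)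
      exact ⟨a, by omega⟩
    · rintro ⟨a, b⟩
      exact ⟨a, by omega⟩

theorem cntGe_between (X : Finset ℕ) (m y : ℕ) (h : m < y) :
    cntGe X (m + 1) = (X.filter (fun x => m < x ∧ x < y)).card + cntGe X y := by
  unfold cntGe
  rw [← Finset.card_union_of_disjoint]
  · congr 1
    ext x; simp only [Finset.mem_filter, Finset.mem_union]
    by_cases hx : x ∈ X <;> simp only [hx, true_and, false_and, or_false]
    omega
  · rw [Finset.disjoint_left]
    intro x; simp only [Finset.mem_filter]
    rintro ⟨-, h1⟩ ⟨-, h2⟩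
    omega

theorem records (R A N : Finset ℕ) (hd : ∀ x ∈ R, x ∉ A)
    (hN : N = R.filter (fun m => ∀ m' ∈ A, m < m' →
      (A.filter (fun x => m < x ∧ x < m')).card <
      (R.filter (fun x => m < x ∧ x < m')).card)) (M : ℕ)
    (hM : ∀ x ∈ R, x < M) (n : ℕ) :
    ∀ t, M ≤ t + n → ∀ s, t ≤ s → cntGe R s ≤ cntGe N t + cntGe A s := by
  induction n with
  | zero =>
    intro t ht s hs
    have : cntGe R s = 0 := by
      unfold cntGe
      rw [Finset.card_eq_zero, Finset.filter_eq_empty_iff]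
      intro x hx
      have := hM x hx
      omega
    omega
  | succ n ih =>
    intro t ht s hs
    have ih' := ih (t + 1) (by omega)
    have sN := cntGe_step N t
    rcases Nat.eq_or_lt_of_le hs with rfl | hlt
    · have sR := cntGe_step R t
      have sA := cntGe_step A t
      have i0 := ih' (t + 1) le_rfl
      by_cases hR : t ∈ R
      · have hA := hd t hR
        simp only [hR, hA, if_true, if_false] at sR sA
        by_cases hn : t ∈ N
        · simp only [hn, if_true] at sN
          omega
        · have hn' := hn
          rw [hN, Finset.mem_filter] at hn'
          push Not at hn'
          obtain ⟨y, hy, hty, hc⟩ := hn' hR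
          have bR := cntGe_between R t y hty
          have bA := cntGe_between A t y hty
          have yR := cntGe_step R y
          have yA := cntGe_step A y
          have hyR : y ∉ R := fun h => hd y h hy
          simp only [hyR, hy, if_true, if_false] at yR yA
          have := ih' (y + 1) (by omega)
          omega
      · simp only [hR, if_false] at sR
        omega
    · have := ih' s hlt
      omega

/-- If a partition `μ` has `b` beads on runner `r` and `a` beads on runner `r - 1`
of its `p`-abacus with `b > a`, then `μ` has at least `b - a` normal `r`-nodes. -/
theorem normals_card_ge (p r : ℕ) (S : Finset ℕ)
    (hp : 2 ≤ p) (hr : 0 < r) (hrp : r < p)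
    (hba : (S.filter (fun m => m % p = r - 1)).card
      < (S.filter (fun m => m % p = r)).card) :
    (S.filter (fun m => m % p = r)).card - (S.filter (fun m => m % p = r - 1)).card
      ≤ (normals p r S).card := by
  have hrec := records (removables p r S) (addables p r S) (normals p r S) (by
    intro x hx hx'
    simp only [removables, addables, Finset.mem_filter] at hx hx'
    exact hx'.2.2 hx.1) rfl (S.sup id + 1) (by
    intro x hx
    simp only [removables, Finset.mem_filter] at hx
    exact Nat.lt_succ_of_le (Finset.le_sup (f := id) hx.1)) (S.sup id + 1) 0 (by omega) 0 le_rfl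
  simp only [cntGe, Nat.zero_le, Finset.filter_true] at hrec
  set B := S.filter (fun m => m % p = r) with hB
  set I := (S.filter (fun m => m % p = r - 1)).image (fun m => m + 1) with hI
  have cI : I.card = (S.filter (fun m => m % p = r - 1)).card :=
    Finset.card_image_of_injective _ (add_left_injective 1)
  have memI : ∀ k, k + 1 ∈ I ↔ k ∈ S ∧ (k + 1) % p = r := by
    intro k
    rw [mod_succ_iff p r k hr hrp]
    simp [hI]
  have memI0 : 0 ∉ I := by simp [hI]
  have eR : removables p r S = B \ I := by
    ext x
    cases x with
    | zero =>
      simp only [removables, hB, Finset.mem_filter, Finset.mem_sdiff, Nat.zero_mod]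
      constructor
      · rintro ⟨_, _, h, _⟩; omega
      · rintro ⟨⟨_, h⟩, _⟩; omega
    | succ k =>
      simp only [removables, hB, Finset.mem_filter, Finset.mem_sdiff, memI, Nat.add_sub_cancel]
      have : 0 < k + 1 := by omega
      tauto
  have eA : addables p r S = I \ B := by
    ext x
    cases x with
    | zero => simp [addables, memI0]
    | succ k =>
      simp only [addables, hB, Finset.mem_filter, Finset.mem_sdiff, memI, Finset.mem_image,
        Nat.add_right_cancel_iff, exists_eq_right]
      tauto
  have c1 := Finset.card_sdiff_add_card_inter B I
  have c2 := Finset.card_sdiff_add_card_inter I B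
  rw [Finset.inter_comm] at c2
  rw [eR, eA] at hrec
  omega
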